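/- Let n ≥ 3 be an integer and let H ≥ (n-1)/n be a real number. Define λ_{H,0}(ρ) = ∫₀^ρ nH·I_{n-1}(t)/√(sinh(t)^(2n-2) − (nH·I_{n-1}(t))²) dt. Let r₁ : ℝ → ℝ and ρ* : ℝ → ℝ be functions such that for every d < 0: r₁(d) > 0 and (n-1)·I_{n-1}(r₁(d)) + d = 0, and ρ*(d) > 0 and λ_{H,0}(ρ*(d)) = h*(d), where h*(d) = −∫_{r₀(d)}^{r₁(d)} ((n-1)·I_{n-1}(t) + d)/sinh(t)^(n-1) dt and r₀(d) > 0 is the unique positive solution of sinh(ρ)^(n-1) + (n-1)·I_{n-1}(ρ) + d = 0. Then r₁(d)/ρ*(d) tends to 0 as d tends to 0 from the left, and ρ*(d) tends to 0 as d tends to 0 from the left. -/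

import Mathlib

/-- `I_m(t) = ∫₀^t sinh(τ)^m dτ`. -/
noncomputable def Ifun (m : ℕ) (t : ℝ) : ℝ := ∫ τ in (0:ℝ)..t, Real.sinh τ ^ m

/-- The generating curve `λ_{H,0}` of the rotationally invariant CMC `H` hypersurface. -/
noncomputable def lam (n : ℕ) (H ρ : ℝ) : ℝ :=
  ∫ t in (0:ℝ)..ρ,
    (n : ℝ) * H * Ifun (n - 1) t /
      Real.sqrt (Real.sinh t ^ (2 * n - 2) - ((n : ℝ) * H * Ifun (n - 1) t) ^ 2)

/-- `h*(d) = −∫_{r₀}^{r₁} ((n-1)I_{n-1}(t)+d)/sinh(t)^(n-1) dt`. -/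
noncomputable def hstar (n : ℕ) (r₀ r₁ d : ℝ) : ℝ :=
  -(∫ t in r₀..r₁, (((n : ℝ) - 1) * Ifun (n - 1) t + d) / Real.sinh t ^ (n - 1))

open Filter Topology Set

lemma Real.sinh_le_two_mul {x : ℝ} (hx : 0 ≤ x) (hx1 : x ≤ 1) : Real.sinh x ≤ 2 * x := by
  have h1 := abs_le.1 (Real.abs_exp_sub_one_sub_id_le (x := x) (by rw [abs_of_nonneg hx]; exact hx1))
  have h2 := abs_le.1 (Real.abs_exp_sub_one_sub_id_le (x := -x)
    (by rw [abs_neg, abs_of_nonneg hx]; exact hx1))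
  rw [Real.sinh_eq]
  nlinarith

lemma tendsto_zero_of_pow {α : Type*} {l : Filter α} {q : α → ℝ} {k : ℕ}
    (hq : ∀ᶠ a in l, 0 ≤ q a) (h : Tendsto (fun a => q a ^ k) l (𝓝 0)) :
    Tendsto q l (𝓝 0) := by
  refine tendsto_order.2 ⟨fun a ha => hq.mono fun x hx => ha.trans_le hx, fun a ha => ?_⟩
  filter_upwards [(tendsto_order.1 h).2 (a ^ k) (pow_pos ha k)] with x hx
  exact lt_of_pow_lt_pow_left₀ k ha.le hx

lemma continuous_Ifun (m : ℕ) : Continuous (Ifun m) :=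
  intervalIntegral.continuous_primitive
    (fun a b => (Real.continuous_sinh.pow m).intervalIntegrable a b) 0

lemma Ifun_sub (m : ℕ) (a b : ℝ) : Ifun m b - Ifun m a = ∫ τ in a..b, Real.sinh τ ^ m :=
  intervalIntegral.integral_interval_sub_left
    ((Real.continuous_sinh.pow m).intervalIntegrable _ _)
    ((Real.continuous_sinh.pow m).intervalIntegrable _ _)

lemma Ifun_strictMonoOn (m : ℕ) : StrictMonoOn (Ifun m) (Ici 0) := by
  intro a ha b _ hab
  rw [← sub_pos, Ifun_sub]
  refine intervalIntegral.intervalIntegral_pos_of_pos_on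
    ((Real.continuous_sinh.pow m).intervalIntegrable _ _) (fun x hx => ?_) hab
  exact pow_pos (Real.sinh_pos_iff.2 (lt_of_le_of_lt ha hx.1)) m

lemma Ifun_zero (m : ℕ) : Ifun m 0 = 0 := by simp [Ifun]

lemma Ifun_pos (m : ℕ) {t : ℝ} (ht : 0 < t) : 0 < Ifun m t := by
  simpa [Ifun_zero] using Ifun_strictMonoOn m self_mem_Ici (mem_Ici.2 ht.le) ht

lemma Ifun_le (m : ℕ) {t : ℝ} (ht : 0 ≤ t) : Ifun m t ≤ t * Real.sinh t ^ m := by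
  have h := intervalIntegral.integral_mono_on (μ := MeasureTheory.volume) ht
    ((Real.continuous_sinh.pow m).intervalIntegrable 0 t)
    (intervalIntegrable_const (c := Real.sinh t ^ m))
    (fun x hx => pow_le_pow_left₀ (Real.sinh_nonneg_iff.2 hx.1) (Real.sinh_le_sinh.2 hx.2) m)
  simpa [Ifun] using h

lemma pow_div_le_Ifun (m : ℕ) {t : ℝ} (ht : 0 ≤ t) : t ^ (m + 1) / (m + 1) ≤ Ifun m t := by
  have h := intervalIntegral.integral_mono_on (μ := MeasureTheory.volume) ht
    ((continuous_id.pow m).intervalIntegrable 0 t)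
    ((Real.continuous_sinh.pow m).intervalIntegrable 0 t)
    (fun x hx => pow_le_pow_left₀ hx.1 (Real.self_le_sinh_iff.2 hx.1) m)
  simpa [Ifun] using h

/-- The integrand of `lam`, with `A = n * H` and `m = n - 1`. -/
noncomputable def lamIntegrand (m : ℕ) (A t : ℝ) : ℝ :=
  A * Ifun m t / Real.sqrt (Real.sinh t ^ (2 * m) - (A * Ifun m t) ^ 2)

lemma lamIntegrand_nonneg (m : ℕ) {A t : ℝ} (hA : 0 < A) (ht : 0 ≤ t) :
    0 ≤ lamIntegrand m A t := by
  have h : 0 ≤ Ifun m t := by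
    rcases ht.eq_or_lt with rfl | h
    · rw [Ifun_zero]
    · exact (Ifun_pos m h).le
  unfold lamIntegrand
  positivity

lemma half_sinh_pow_le_sqrt (m : ℕ) {A t : ℝ} (hA : 0 < A) (ht : 0 < t) (hAt : A * t ≤ 1 / 2) :
    Real.sinh t ^ m / 2 ≤ Real.sqrt (Real.sinh t ^ (2 * m) - (A * Ifun m t) ^ 2) := by
  have hs : 0 < Real.sinh t ^ m := pow_pos (Real.sinh_pos_iff.2 ht) m
  have hI := Ifun_pos m ht
  have h1 : A * Ifun m t ≤ Real.sinh t ^ m / 2 := by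
    nlinarith [mul_le_mul_of_nonneg_left (Ifun_le m ht.le) hA.le]
  apply Real.le_sqrt_of_sq_le
  have h2 : (A * Ifun m t) ^ 2 ≤ (Real.sinh t ^ m / 2) ^ 2 :=
    pow_le_pow_left₀ (by positivity) h1 2
  rw [mul_comm 2 m, pow_mul]
  nlinarith

lemma lamIntegrand_pos (m : ℕ) {A t : ℝ} (hA : 0 < A) (ht : 0 < t) (hAt : A * t ≤ 1 / 2) :
    0 < lamIntegrand m A t := by
  have hs : 0 < Real.sinh t ^ m := pow_pos (Real.sinh_pos_iff.2 ht) m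
  exact div_pos (mul_pos hA (Ifun_pos m ht))
    (lt_of_lt_of_le (by positivity) (half_sinh_pow_le_sqrt m hA ht hAt))

lemma lamIntegrand_le (m : ℕ) {A t : ℝ} (hA : 0 < A) (ht : 0 ≤ t) (hAt : A * t ≤ 1 / 2) :
    lamIntegrand m A t ≤ 2 * A * t := by
  rcases ht.eq_or_lt with rfl | ht
  · simp [lamIntegrand, Ifun_zero]
  have hs : 0 < Real.sinh t ^ m := pow_pos (Real.sinh_pos_iff.2 ht) m
  have h := half_sinh_pow_le_sqrt m hA ht hAt
  unfold lamIntegrand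
  rw [div_le_iff₀ (lt_of_lt_of_le (by positivity) h)]
  calc A * Ifun m t ≤ A * (t * Real.sinh t ^ m) :=
        mul_le_mul_of_nonneg_left (Ifun_le m ht.le) hA.le
    _ = 2 * A * t * (Real.sinh t ^ m / 2) := by ring
    _ ≤ _ := mul_le_mul_of_nonneg_left h (by positivity)

lemma integral_lamIntegrand_le (m : ℕ) {A ρ : ℝ} (hA : 0 < A) (hρ : 0 ≤ ρ)
    (hAρ : A * ρ ≤ 1 / 2) : ∫ t in (0:ℝ)..ρ, lamIntegrand m A t ≤ A * ρ ^ 2 := by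
  by_cases hi : IntervalIntegrable (lamIntegrand m A) MeasureTheory.volume 0 ρ
  · have h := intervalIntegral.integral_mono_on hρ hi
      ((continuous_const.mul continuous_id).intervalIntegrable 0 ρ)
      (fun x hx => lamIntegrand_le m hA hx.1
        ((mul_le_mul_of_nonneg_left hx.2 hA.le).trans hAρ))
    have e : ∫ t in (0:ℝ)..ρ, 2 * A * t = A * ρ ^ 2 := by
      rw [intervalIntegral.integral_const_mul, integral_id]
      ring
    exact h.trans e.le
  · rw [intervalIntegral.integral_undef hi]
    positivity

/-- The equations defining `r₀` and `r₁`, with `m = n - 1`. -/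
structure IsRadiusPair (m : ℕ) (d r₀ r₁ : ℝ) : Prop where
  pos₀ : 0 < r₀
  eq₀ : Real.sinh r₀ ^ m + m * Ifun m r₀ + d = 0
  pos₁ : 0 < r₁
  eq₁ : m * Ifun m r₁ + d = 0

namespace IsRadiusPair

variable {m : ℕ} {d r₀ r₁ : ℝ}

lemma lt (h : IsRadiusPair m d r₀ r₁) : r₀ < r₁ := by
  have hs : 0 < Real.sinh r₀ ^ m := pow_pos (Real.sinh_pos_iff.2 h.pos₀) m
  have h1 : m * Ifun m r₀ < m * Ifun m r₁ := by linarith [h.eq₀, h.eq₁]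
  exact (Ifun_strictMonoOn m).lt_iff_lt (mem_Ici.2 h.pos₀.le) (mem_Ici.2 h.pos₁.le) |>.1
    (lt_of_mul_lt_mul_left h1 m.cast_nonneg)

lemma intervalIntegrable (m : ℕ) (d : ℝ) {a b : ℝ} (ha : 0 < a) (hab : a ≤ b) :
    IntervalIntegrable (fun t => -((m * Ifun m t + d) / Real.sinh t ^ m))
      MeasureTheory.volume a b := by
  apply ContinuousOn.intervalIntegrable_of_Icc hab
  refine (ContinuousOn.div ?_ ?_ fun x hx => ?_).neg
  · exact ((continuous_const.mul (continuous_Ifun m)).add continuous_const).continuousOn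
  · exact (Real.continuous_sinh.pow m).continuousOn
  · exact (pow_pos (Real.sinh_pos_iff.2 (ha.trans_le hx.1)) m).ne'

lemma integral_le (h : IsRadiusPair m d r₀ r₁) :
    ∫ t in r₀..r₁, -((m * Ifun m t + d) / Real.sinh t ^ m) ≤ r₁ := by
  have h1 := intervalIntegral.integral_mono_on h.lt.le
    (intervalIntegrable m d h.pos₀ h.lt.le) (intervalIntegrable_const (c := (1:ℝ)))
    (fun x hx => by
      have hs : 0 < Real.sinh x ^ m :=
        pow_pos (Real.sinh_pos_iff.2 (h.pos₀.trans_le hx.1)) m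
      have h2 : Real.sinh r₀ ^ m ≤ Real.sinh x ^ m :=
        pow_le_pow_left₀ (Real.sinh_nonneg_iff.2 h.pos₀.le) (Real.sinh_le_sinh.2 hx.1) m
      have h3 : (m:ℝ) * Ifun m r₀ ≤ m * Ifun m x :=
        mul_le_mul_of_nonneg_left ((Ifun_strictMonoOn m).monotoneOn (mem_Ici.2 h.pos₀.le)
          (mem_Ici.2 (h.pos₀.le.trans hx.1)) hx.1) m.cast_nonneg
      rw [← neg_div, div_le_one hs]
      linarith [h.eq₀])
  refine h1.trans ?_
  simp [h.pos₀.le]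

lemma le_integral (h : IsRadiusPair m d r₀ r₁) (hr : 2 * r₀ ≤ 1)
    (hm : 4 * m * r₀ * 4 ^ m ≤ 1) :
    r₀ / (2 * 4 ^ m) ≤ ∫ t in r₀..r₁, -((m * Ifun m t + d) / Real.sinh t ^ m) := by
  have p₀ := h.pos₀
  have hs0 : 0 < Real.sinh r₀ := Real.sinh_pos_iff.2 p₀
  have hsm : 0 < Real.sinh r₀ ^ m := pow_pos hs0 m
  have hs2 : Real.sinh (2 * r₀) ^ m ≤ 4 ^ m * Real.sinh r₀ ^ m := by
    rw [← mul_pow]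
    refine pow_le_pow_left₀ (Real.sinh_nonneg_iff.2 (by positivity)) ?_ m
    linarith [Real.sinh_le_two_mul (by positivity : 0 ≤ 2 * r₀) hr, Real.self_le_sinh_iff.2 p₀.le]
  have hI2 : m * Ifun m (2 * r₀) ≤ Real.sinh r₀ ^ m / 2 := by
    calc m * Ifun m (2 * r₀) ≤ m * (2 * r₀ * (4 ^ m * Real.sinh r₀ ^ m)) := by
          gcongr
          exact (Ifun_le m (by positivity)).trans (by gcongr)
      _ = (4 * m * r₀ * 4 ^ m) * (Real.sinh r₀ ^ m / 2) := by ring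
      _ ≤ 1 * (Real.sinh r₀ ^ m / 2) := by gcongr
      _ = _ := one_mul _
  have hI0 : 0 ≤ m * Ifun m r₀ := mul_nonneg m.cast_nonneg (Ifun_pos m p₀).le
  have h2 : 2 * r₀ ≤ r₁ := by
    have h1 : m * Ifun m (2 * r₀) < m * Ifun m r₁ := by linarith [h.eq₀, h.eq₁]
    exact ((Ifun_strictMonoOn m).lt_iff_lt (mem_Ici.2 (by positivity)) (mem_Ici.2 h.pos₁.le) |>.1
      (lt_of_mul_lt_mul_left h1 m.cast_nonneg)).le
  have hmono : ∀ a b : ℝ, 0 ≤ a → a ≤ b → m * Ifun m a ≤ m * Ifun m b := fun a b ha hab =>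
    mul_le_mul_of_nonneg_left ((Ifun_strictMonoOn m).monotoneOn (mem_Ici.2 ha)
      (mem_Ici.2 (ha.trans hab)) hab) m.cast_nonneg
  have hA := intervalIntegral.integral_mono_on (by linarith : r₀ ≤ 2 * r₀)
    (intervalIntegrable_const (c := 1 / (2 * 4 ^ m : ℝ)))
    (intervalIntegrable m d p₀ (by linarith : r₀ ≤ 2 * r₀))
    (fun x hx => by
      have hs : 0 < Real.sinh x ^ m := pow_pos (Real.sinh_pos_iff.2 (p₀.trans_le hx.1)) m
      have h3 : Real.sinh x ^ m ≤ Real.sinh (2 * r₀) ^ m :=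
        pow_le_pow_left₀ (Real.sinh_nonneg_iff.2 (p₀.le.trans hx.1)) (Real.sinh_le_sinh.2 hx.2) m
      have h4 := hmono x (2 * r₀) (p₀.le.trans hx.1) hx.2
      rw [← neg_div, div_le_div_iff₀ (by positivity) hs]
      have h5 : Real.sinh r₀ ^ m / 2 ≤ -(m * Ifun m x + d) := by linarith [h.eq₀]
      have h6 := mul_le_mul_of_nonneg_right h5 (by positivity : (0:ℝ) ≤ 2 * 4 ^ m)
      linarith)
  have hB : 0 ≤ ∫ t in (2 * r₀)..r₁, -((m * Ifun m t + d) / Real.sinh t ^ m) := by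
    refine intervalIntegral.integral_nonneg h2 fun x hx => ?_
    have hx0 : 0 ≤ x := by linarith [hx.1]
    have hs : 0 ≤ Real.sinh x ^ m := pow_nonneg (Real.sinh_nonneg_iff.2 hx0) m
    rw [← neg_div]
    exact div_nonneg (by linarith [hmono x r₁ hx0 hx.2, h.eq₁]) hs
  rw [← intervalIntegral.integral_add_adjacent_intervals
    (intervalIntegrable m d p₀ (by linarith : r₀ ≤ 2 * r₀))
    (intervalIntegrable m d (by positivity : 0 < 2 * r₀) h2)]
  rw [intervalIntegral.integral_const, smul_eq_mul] at hA
  have : (2 * r₀ - r₀) * (1 / (2 * 4 ^ m : ℝ)) = r₀ / (2 * 4 ^ m) := by ring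
  linarith

lemma pow_le_neg (h : IsRadiusPair m d r₀ r₁) (hm : 1 ≤ m) : r₁ ^ (m + 1) ≤ 2 * -d := by
  have h1 := pow_div_le_Ifun m h.pos₁.le
  have hm' : (1:ℝ) ≤ m := by exact_mod_cast hm
  rw [div_le_iff₀ (by positivity)] at h1
  have hI := Ifun_pos m h.pos₁
  nlinarith [h.eq₁, mul_le_mul_of_nonneg_right hm' hI.le]

lemma pow_le_pow (h : IsRadiusPair m d r₀ r₁) (hm : 1 ≤ m) (hr : 2 * r₀ ≤ 1)
    (hmr : m * r₀ ≤ 1) : r₁ ^ (m + 1) ≤ 4 * (2 * r₀) ^ m := by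
  have p₀ := h.pos₀
  have hs0 : 0 < Real.sinh r₀ := Real.sinh_pos_iff.2 p₀
  have h1 := h.pow_le_neg hm
  have h2 : m * Ifun m r₀ ≤ 1 * Real.sinh r₀ ^ m := by
    calc m * Ifun m r₀ ≤ m * (r₀ * Real.sinh r₀ ^ m) := by
          gcongr
          exact Ifun_le m p₀.le
      _ = m * r₀ * Real.sinh r₀ ^ m := by ring
      _ ≤ _ := by gcongr
  have h3 : Real.sinh r₀ ^ m ≤ (2 * r₀) ^ m :=
    pow_le_pow_left₀ hs0.le (Real.sinh_le_two_mul p₀.le (by linarith)) m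
  linarith [h.eq₀]

end IsRadiusPair

lemma ratio_pow_le {k : ℕ} {A c r₀ r₁ ρ : ℝ} (hc : 0 < c) (h₀ : 0 < r₀)
    (h₁ : 0 < r₁) (hρ : 0 < ρ) (hlow : r₀ / c ≤ A * ρ ^ 2)
    (hpow : r₁ ^ (k + 2) ≤ 4 * (2 * r₀) ^ (k + 1)) :
    (r₁ / ρ) ^ (2 * (k + 2)) ≤ (c * A) ^ (k + 2) * (16 * 4 ^ (k + 1)) * r₀ ^ k := by
  have hle : r₀ ≤ c * A * ρ ^ 2 := by
    rw [div_le_iff₀ hc] at hlow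
    linarith
  have e1 : r₀ ^ (k + 2) ≤ (c * A * ρ ^ 2) ^ (k + 2) := pow_le_pow_left₀ h₀.le hle _
  have e2 : (r₁ ^ (k + 2)) ^ 2 ≤ (4 * (2 * r₀) ^ (k + 1)) ^ 2 :=
    pow_le_pow_left₀ (by positivity) hpow 2
  rw [div_pow, div_le_iff₀ (by positivity)]
  calc r₁ ^ (2 * (k + 2)) = (r₁ ^ (k + 2)) ^ 2 := by rw [mul_comm, pow_mul]
    _ ≤ (4 * (2 * r₀) ^ (k + 1)) ^ 2 := e2
    _ = 16 * 4 ^ (k + 1) * r₀ ^ k * r₀ ^ (k + 2) := by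
        rw [mul_pow, mul_pow, mul_pow, ← pow_mul, mul_comm (k + 1) 2, pow_mul]
        ring
    _ ≤ 16 * 4 ^ (k + 1) * r₀ ^ k * (c * A * ρ ^ 2) ^ (k + 2) := by gcongr
    _ = _ := by
        rw [mul_pow _ (ρ ^ 2), ← pow_mul]
        ring

/-- The integral of `lamIntegrand` being nonzero forces integrability, so smallness of a positive
value forces smallness of the radius. -/
lemma eventually_lt_of_integral_lamIntegrand (m : ℕ) {A : ℝ} (hA : 0 < A) {α : Type*}
    {l : Filter α} {ρ : α → ℝ}
    (hpos : ∀ᶠ a in l, 0 < ∫ t in (0:ℝ)..ρ a, lamIntegrand m A t)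
    (hlim : Tendsto (fun a => ∫ t in (0:ℝ)..ρ a, lamIntegrand m A t) l (𝓝 0))
    {ε : ℝ} (hε : 0 < ε) : ∀ᶠ a in l, ρ a < ε := by
  obtain ⟨δ, hδ, hδε, hAδ⟩ : ∃ δ > 0, δ ≤ ε ∧ A * δ ≤ 1 / 2 :=
    ⟨min ε (1 / (2 * A)), by positivity, min_le_left _ _, by
      calc A * min ε (1 / (2 * A)) ≤ A * (1 / (2 * A)) := by gcongr; exact min_le_right _ _
        _ = 1 / 2 := by field_simp⟩
  have key : ∀ b, δ ≤ b → (0 < ∫ t in (0:ℝ)..b, lamIntegrand m A t) →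
      IntervalIntegrable (lamIntegrand m A) MeasureTheory.volume 0 δ ∧
      ∫ t in (0:ℝ)..δ, lamIntegrand m A t ≤ ∫ t in (0:ℝ)..b, lamIntegrand m A t := by
    intro b hb hp
    have hi : IntervalIntegrable (lamIntegrand m A) MeasureTheory.volume 0 b := by
      by_contra hi
      rw [intervalIntegral.integral_undef hi] at hp
      exact hp.false
    refine ⟨hi.mono_set ?_, ?_⟩
    · rw [uIcc_of_le hδ.le, uIcc_of_le (hδ.le.trans hb)]
      exact Icc_subset_Icc_right hb
    · refine intervalIntegral.integral_mono_interval le_rfl hδ.le hb ?_ hi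
      filter_upwards [MeasureTheory.ae_restrict_mem measurableSet_Ioc] with x hx
      exact lamIntegrand_nonneg m hA hx.1.le
  by_cases hi : IntervalIntegrable (lamIntegrand m A) MeasureTheory.volume 0 δ
  · have hp : 0 < ∫ t in (0:ℝ)..δ, lamIntegrand m A t :=
      intervalIntegral.intervalIntegral_pos_of_pos_on hi (fun x hx => lamIntegrand_pos m hA hx.1
        ((mul_le_mul_of_nonneg_left hx.2.le hA.le).trans hAδ)) hδ
    filter_upwards [hpos, (tendsto_order.1 hlim).2 _ hp] with a ha1 ha2
    by_contra! hb
    exact absurd (key _ (hδε.trans hb) ha1).2 (not_le.2 ha2)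
  · filter_upwards [hpos] with a ha
    by_contra! hb
    exact hi (key _ (hδε.trans hb) ha).1


/-- For `n ≥ 3` and `H ≥ (n-1)/n`, with `r₀, r₁, ρ*` as in the paper (and
`λ_{H,0}(ρ*(d)) = h*(d)`), one has `r₁(d)/ρ*(d) → 0` and `ρ*(d) → 0` as `d → 0⁻`. -/
theorem statement17 (n : ℕ) (hn : 3 ≤ n) (H : ℝ) (hH : H ≥ ((n : ℝ) - 1) / n)
    (r₀ r₁ ρstar : ℝ → ℝ)
    (h₀ : ∀ d : ℝ, d < 0 → 0 < r₀ d ∧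
      Real.sinh (r₀ d) ^ (n - 1) + ((n : ℝ) - 1) * Ifun (n - 1) (r₀ d) + d = 0)
    (huniq₀ : ∀ d : ℝ, d < 0 → ∀ ρ : ℝ, 0 < ρ →
      Real.sinh ρ ^ (n - 1) + ((n : ℝ) - 1) * Ifun (n - 1) ρ + d = 0 → ρ = r₀ d)
    (h₁ : ∀ d : ℝ, d < 0 →
      0 < r₁ d ∧ ((n : ℝ) - 1) * Ifun (n - 1) (r₁ d) + d = 0)
    (hρ : ∀ d : ℝ, d < 0 →
      0 < ρstar d ∧ lam n H (ρstar d) = hstar n (r₀ d) (r₁ d) d) :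
    Filter.Tendsto (fun d : ℝ => r₁ d / ρstar d) (nhdsWithin 0 (Set.Iio 0)) (nhds 0) ∧
    Filter.Tendsto ρstar (nhdsWithin 0 (Set.Iio 0)) (nhds 0) := by
  obtain ⟨k, rfl⟩ : ∃ k, n = k + 2 := ⟨n - 2, by omega⟩
  have hk : k ≠ 0 := by omega
  set A : ℝ := ((k + 2 : ℕ) : ℝ) * H with hAdef
  have hA : 0 < A := by
    have h1 : (0:ℝ) < ((k + 2 : ℕ) : ℝ) - 1 := by push_cast; linarith [k.cast_nonneg (α := ℝ)]
    exact mul_pos (by positivity) ((div_pos h1 (by positivity)).trans_le hH)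
  have hcast : ((k + 2 : ℕ) : ℝ) - 1 = ((k + 1 : ℕ) : ℝ) := by push_cast; ring
  have hpair : ∀ d < 0, IsRadiusPair (k + 1) d (r₀ d) (r₁ d) := fun d hd =>
    ⟨(h₀ d hd).1, by rw [← hcast]; exact (h₀ d hd).2, (h₁ d hd).1,
      by rw [← hcast]; exact (h₁ d hd).2⟩
  have hlam : ∀ d < 0, ∫ t in (0:ℝ)..ρstar d, lamIntegrand (k + 1) A t =
      ∫ t in r₀ d..r₁ d,
        -((((k + 1 : ℕ) : ℝ) * Ifun (k + 1) t + d) / Real.sinh t ^ (k + 1)) := by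
    intro d hd
    rw [intervalIntegral.integral_neg, ← hcast]
    exact (hρ d hd).2
  have hneg : ∀ᶠ d in 𝓝[<] (0:ℝ), d < 0 := self_mem_nhdsWithin
  have hr₁ : Tendsto r₁ (𝓝[<] 0) (𝓝 0) := by
    refine tendsto_zero_of_pow (k := k + 2) (hneg.mono fun d hd => (h₁ d hd).1.le) ?_
    have hlin : Tendsto (fun d : ℝ => 2 * -d) (𝓝[<] 0) (𝓝 0) := by
      have : Continuous fun d : ℝ => 2 * -d := by fun_prop
      simpa using (this.tendsto 0).mono_left nhdsWithin_le_nhds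
    refine squeeze_zero' (hneg.mono fun d hd => pow_nonneg (h₁ d hd).1.le _)
      (hneg.mono fun d hd => ?_) hlin
    exact (hpair d hd).pow_le_neg (by omega)
  have hr₀ : Tendsto r₀ (𝓝[<] 0) (𝓝 0) :=
    squeeze_zero' (hneg.mono fun d hd => (h₀ d hd).1.le)
      (hneg.mono fun d hd => (hpair d hd).lt.le) hr₁
  set c : ℝ := 2 * 4 ^ (k + 1) with hc
  have hc0 : 0 < c := by positivity
  have hsmall : ∀ᶠ d in 𝓝[<] (0:ℝ),
      2 * r₀ d ≤ 1 ∧ 4 * ((k + 1 : ℕ) : ℝ) * r₀ d * 4 ^ (k + 1) ≤ 1 := by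
    have t1 := hr₀.const_mul 2
    have t2 := (hr₀.const_mul (4 * ((k + 1 : ℕ) : ℝ))).mul_const (4 ^ (k + 1))
    simp only [mul_zero, zero_mul] at t1 t2
    exact (t1.eventually_le_const one_pos).and (t2.eventually_le_const one_pos)
  have hlow : ∀ᶠ d in 𝓝[<] (0:ℝ),
      r₀ d / c ≤ ∫ t in (0:ℝ)..ρstar d, lamIntegrand (k + 1) A t := by
    filter_upwards [hneg, hsmall] with d hd hs
    rw [hlam d hd]
    exact (hpair d hd).le_integral hs.1 hs.2
  have hpos : ∀ᶠ d in 𝓝[<] (0:ℝ), 0 < ∫ t in (0:ℝ)..ρstar d, lamIntegrand (k + 1) A t := by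
    filter_upwards [hneg, hlow] with d hd h
    exact (div_pos (h₀ d hd).1 hc0).trans_le h
  have hlim : Tendsto (fun d => ∫ t in (0:ℝ)..ρstar d, lamIntegrand (k + 1) A t)
      (𝓝[<] 0) (𝓝 0) := by
    refine squeeze_zero' (hpos.mono fun d h => h.le) (hneg.mono fun d hd => ?_) hr₁
    rw [hlam d hd]
    exact (hpair d hd).integral_le
  have hρ₀ : Tendsto ρstar (𝓝[<] 0) (𝓝 0) :=
    tendsto_order.2 ⟨fun a ha => hneg.mono fun d hd => ha.trans (hρ d hd).1,
      fun ε hε => eventually_lt_of_integral_lamIntegrand (k + 1) hA hpos hlim hε⟩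
  refine ⟨?_, hρ₀⟩
  refine tendsto_zero_of_pow (k := 2 * (k + 2))
    (hneg.mono fun d hd => (div_pos (h₁ d hd).1 (hρ d hd).1).le) ?_
  have hbound := (hr₀.pow k).const_mul ((c * A) ^ (k + 2) * (16 * 4 ^ (k + 1)))
  rw [zero_pow hk, mul_zero] at hbound
  have hAρ := hρ₀.const_mul A
  rw [mul_zero] at hAρ
  refine squeeze_zero'
    (hneg.mono fun d hd => pow_nonneg (div_pos (h₁ d hd).1 (hρ d hd).1).le _) ?_ hbound
  filter_upwards [hneg, hsmall, hlow, hAρ.eventually_le_const one_half_pos] with d hd hs hl ha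
  refine ratio_pow_le hc0 (h₀ d hd).1 (h₁ d hd).1 (hρ d hd).1
    (hl.trans (integral_lamIntegrand_le (k + 1) hA (hρ d hd).1.le ha))
    ((hpair d hd).pow_le_pow (by omega) hs.1 ?_)
  have hone : (1:ℝ) ≤ 4 ^ (k + 1) := one_le_pow₀ (by norm_num)
  have hnn : 0 ≤ ((k + 1 : ℕ) : ℝ) * r₀ d := mul_nonneg (Nat.cast_nonneg _) (h₀ d hd).1.le
  nlinarith [hs.2, mul_le_mul_of_nonneg_left hone hnn]
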